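/- arXiv:1008.3854 — 5 statements merged into one kernel-verified Lean document; each statement's English description precedes it below -/
import Mathlib

section
/- For every c > 0 and every x ∈ ℝ: ∫_{−1}^1 φ₂(x−z)·Ω̃_c″(z) dz = sign(1−c)·(1/c²)·φ₂((1+c²+2cx)/2) − ((1−c²)/(2c))·x − J̃_c(x) + (−3+4c²+3c⁴)/(16c²) − [c>1]·(x + (1+c²)/(2c))²·ln c, where [c>1] equals 1 if c > 1 and 0 otherwise. -/
open MeasureTheory Real Filter Topology
open scoped Classical

noncomputable section

/-- `φ₀(x) = −ln|2x|`. -/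
def phi0 (x : ℝ) : ℝ := -Real.log |2*x|

/-- `φ₁(x) = x − x·ln|2x|` (an antiderivative of `φ₀`, with `φ₁(0) = 0`). -/
def phi1 (x : ℝ) : ℝ := x - x * Real.log |2*x|

/-- `φ₂(x) = (3/4)x² − (1/2)x²·ln(2|x|)` (an antiderivative of `φ₁`, `φ₂(0) = 0`). -/
def phi2 (x : ℝ) : ℝ := (3/4)*x^2 - (1/2)*x^2*Real.log (2*|x|)

/-- The inverse hyperbolic cosine `arccosh x = ln(x + √(x²−1))` (for `x ≥ 1`). -/
def arccosh (x : ℝ) : ℝ := Real.log (x + Real.sqrt (x^2 - 1))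

/-- The function `H̃_c`: zero on `[−1,1]`, and the stated combination of
`arccosh` terms for `|z| > 1`. -/
def Htilde (c z : ℝ) : ℝ :=
  if |z| ≤ 1 then 0 else
    (z - (1 - c^2)/(2*c)) * arccosh |z|
    + Real.sign (1 - c) * (z + (1 + c^2)/(2*c)) *
        arccosh |(1 + ((1+c^2)/(2*c))*z)/(z + (1+c^2)/(2*c))|
    - Real.sign z * Real.sqrt (z^2 - 1)

/-- `H_c(s) = H̃_c(s − c/2)`. -/
def Hc (c s : ℝ) : ℝ := Htilde c (s - c/2)

/-- The function `J̃_c`: zero on `[−1,1]` and the stated combination for `|z| > 1`. -/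
def Jtilde (c z : ℝ) : ℝ :=
  if |z| ≤ 1 then 0 else
    (1/2) * (1 - 1/(2*c^2) + (z + (c^2-1)/(2*c))^2) * arccosh |z|
    + Real.sign z * ((1 - c^2 - 3*c*z)/(4*c)) * Real.sqrt (z^2-1)
    + Real.sign (1-c) * (1/2) * (z + (c^2+1)/(2*c))^2 *
        arccosh |(1 + ((1+c^2)/(2*c))*z)/(z + (1+c^2)/(2*c))|

theorem cauchyN (n : ℕ) {f : ℂ → ℂ} (hf : DiffContOnCl ℂ f (Metric.ball 0 1)) :
    ∫ θ in (0:ℝ)..2*π, ((circleMap 0 1 θ)⁻¹)^n * f (circleMap 0 1 θ) =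
      2*π / n.factorial * iteratedDeriv n f 0 := by
  have h := DiffContOnCl.circleIntegral_one_div_sub_center_pow_smul one_pos n hf
  simp only [circleIntegral, deriv_circleMap, sub_zero, smul_eq_mul] at h
  have h2 : ∀ θ : ℝ, circleMap 0 1 θ * Complex.I * (1 / circleMap 0 1 θ ^ (n+1) * f (circleMap 0 1 θ))
      = Complex.I * (((circleMap 0 1 θ)⁻¹)^n * f (circleMap 0 1 θ)) := by
    intro θ
    have : circleMap 0 1 θ ≠ 0 := circleMap_ne_center one_ne_zero
    rw [inv_pow, pow_succ]
    field_simp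
  simp only [h2] at h
  rw [intervalIntegral.integral_const_mul] at h
  apply mul_left_cancel₀ Complex.I_ne_zero
  rw [h]; ring

theorem cauchyPos (n : ℕ) {f : ℂ → ℂ} (hf : DiffContOnCl ℂ f (Metric.ball 0 1)) :
    ∫ θ in (0:ℝ)..2*π, (circleMap 0 1 θ)^n * f (circleMap 0 1 θ) =
      2*π * (0 ^ n * f 0) := by
  have hg : DiffContOnCl ℂ (fun z => z^n * f z) (Metric.ball 0 |1|) := by
    rw [abs_one]
    exact DiffContOnCl.smul (f := f) (c := fun z : ℂ => z^n) (Differentiable.diffContOnCl (by fun_prop)) hf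
  have h := hg.circleAverage
  rw [Real.circleAverage] at h
  rw [← h, Complex.real_smul]
  push_cast
  have : (π:ℂ) ≠ 0 := by exact_mod_cast pi_ne_zero
  field_simp

theorem cont_of (f : ℂ → ℂ) (hf : DiffContOnCl ℂ f (Metric.ball 0 1)) :
    Continuous fun θ : ℝ => f (circleMap 0 1 θ) := by
  have := hf.2
  rw [closure_ball _ one_ne_zero] at this
  exact this.comp_continuous (by fun_prop) (fun θ => circleMap_mem_closedBall _ zero_le_one θ)

theorem cosN (n : ℕ) {f : ℂ → ℂ} (hf : DiffContOnCl ℂ f (Metric.ball 0 1)) (h0 : f 0 = 0) :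
    ∫ θ in (0:ℝ)..2*π, (Real.cos (n*θ) : ℂ) * f (circleMap 0 1 θ) =
      π / n.factorial * iteratedDeriv n f 0 := by
  have h1 := cauchyN n hf
  have h2 := cauchyPos n hf
  have hc := cont_of f hf
  have hi : Continuous fun θ : ℝ => (circleMap 0 1 θ)⁻¹ :=
    Continuous.inv₀ (by fun_prop) (fun θ => circleMap_ne_center one_ne_zero)
  have hm : Continuous fun θ : ℝ => (circleMap 0 1 θ) := by fun_prop
  have e : ∀ θ : ℝ, (Real.cos (n*θ) : ℂ) * f (circleMap 0 1 θ) =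
     (1/2) * (((circleMap 0 1 θ)⁻¹)^n * f (circleMap 0 1 θ)) +
      (1/2) * ((circleMap 0 1 θ)^n * f (circleMap 0 1 θ)) := by
    intro θ
    simp only [circleMap, zero_add, Complex.ofReal_one, one_mul]
    rw [← Complex.exp_neg, ← Complex.exp_nat_mul, ← Complex.exp_nat_mul]
    push_cast
    rw [Complex.cos]
    ring_nf
  simp only [e]
  rw [intervalIntegral.integral_add, intervalIntegral.integral_const_mul,
    intervalIntegral.integral_const_mul, h1, h2, h0]
  · ring
  · exact Continuous.intervalIntegrable (continuous_const.mul ((hi.pow n).mul hc)) _ _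
  · exact Continuous.intervalIntegrable (continuous_const.mul ((hm.pow n).mul hc)) _ _

def fv (v z : ℂ) : ℂ := Complex.log (1 - v * z)

theorem slit {v z : ℂ} (h : ‖v * z‖ < 1) : 1 - v * z ∈ Complex.slitPlane := by
  have := Complex.mem_slitPlane_of_norm_lt_one (z := -(v*z)) (by simpa using h)
  simpa [sub_eq_add_neg] using this

theorem fv_hasDeriv {v z : ℂ} (h : ‖v * z‖ < 1) : HasDerivAt (fv v) (-v / (1 - v*z)) z := by
  have h1 : HasDerivAt (fun z => 1 - v * z) (-v) z := by
    simpa using ((hasDerivAt_id z).const_mul v).const_sub 1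
  exact h1.clog (slit h)

theorem fv_diff {v : ℂ} (hv : ‖v‖ < 1) : DiffContOnCl ℂ (fv v) (Metric.ball 0 1) := by
  apply DifferentiableOn.diffContOnCl
  rw [closure_ball _ one_ne_zero]
  intro z hz
  have hz' : ‖z‖ ≤ 1 := by simpa using hz
  have : ‖v*z‖ < 1 := by
    rw [norm_mul]; nlinarith [norm_nonneg v, norm_nonneg z]
  exact (fv_hasDeriv this).differentiableAt.differentiableWithinAt

theorem fv_zero (v : ℂ) : fv v 0 = 0 := by simp [fv]

theorem fv_d1 (v : ℂ) : iteratedDeriv 1 (fv v) 0 = -v := by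
  rw [iteratedDeriv_one, (fv_hasDeriv (v := v) (z := 0) (by simp)).deriv]; simp

theorem fv_d2 (v : ℂ) : iteratedDeriv 2 (fv v) 0 = -v^2 := by
  rw [iteratedDeriv_succ, iteratedDeriv_one]
  have : deriv (fv v) =ᶠ[𝓝 0] fun z => -v / (1 - v*z) := by
    have : ∀ᶠ z : ℂ in 𝓝 0, ‖v * z‖ < 1 := by
      have hc : Continuous fun z : ℂ => ‖v * z‖ := by fun_prop
      exact hc.continuousAt.eventually_lt continuousAt_const (by simp)
    filter_upwards [this] with z hz using (fv_hasDeriv hz).deriv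
  rw [this.deriv_eq]
  have h1 : HasDerivAt (fun z => 1 - v * z) (-v) 0 := by
    simpa using ((hasDerivAt_id (0:ℂ)).const_mul v).const_sub 1
  have h2 := (h1.inv (by simp)).const_mul (-v)
  have h3 := h2.deriv
  simp only [div_eq_mul_inv]
  rw [show (fun z => -v * (1 - v*z)⁻¹) = (fun y => -v * (fun z => 1 - v * z)⁻¹ y) from rfl, h3]
  simp; ring

def PK (d θ : ℝ) : ℝ := (1 - d^2) / (1 + d^2 + 2*d*Real.cos θ)

theorem PK_den {d θ : ℝ} (h0 : 0 < d) (h1 : d < 1) : 0 < 1 + d^2 + 2*d*Real.cos θ := by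
  nlinarith [Real.neg_one_le_cos θ]

theorem PK_cont {d : ℝ} (h0 : 0 < d) (h1 : d < 1) : Continuous (PK d) := by
  unfold PK
  exact Continuous.div (by fun_prop) (by fun_prop) (fun θ => (PK_den h0 h1).ne')

theorem poissonF {d : ℝ} (h0 : 0 < d) (h1 : d < 1) {f : ℂ → ℂ} (hf : DiffContOnCl ℂ f (Metric.ball 0 1)) :
    ∫ θ in (0:ℝ)..2*π, (PK d θ : ℂ) * f (circleMap 0 1 θ) = 2*π * f (-d) := by
  have h := hf.circleAverage_poissonKernel_smul' (w := (-d:ℂ)) (by simp [abs_of_pos h0, h1])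
  rw [Real.circleAverage] at h
  rw [← h, Complex.real_smul]
  have : ∀ θ : ℝ, (((‖circleMap 0 1 θ - 0‖^2 - ‖(-d:ℂ) - 0‖^2) / ‖circleMap 0 1 θ - 0 - ((-d:ℂ) - 0)‖^2 : ℝ) • f (circleMap 0 1 θ)) = (PK d θ : ℂ) * f (circleMap 0 1 θ) := by
    intro θ
    rw [Complex.real_smul]
    congr 2
    rw [PK]
    congr 1
    · simp
    · rw [← Complex.normSq_eq_norm_sq, Complex.normSq_apply]
      simp [circleMap, Complex.exp_re, Complex.exp_im]
      nlinarith [Real.sin_sq_add_cos_sq θ]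
  simp only [this]
  push_cast
  have : (π:ℂ) ≠ 0 := by exact_mod_cast pi_ne_zero
  field_simp

def lv (v : ℂ) (θ : ℝ) : ℝ := Real.log ‖1 - v * circleMap 0 1 θ‖

theorem lv_eq (v : ℂ) (θ : ℝ) : lv v θ = (fv v (circleMap 0 1 θ)).re := by
  simp [lv, fv, Complex.log_re]

theorem re_int {v : ℂ} (hv : ‖v‖ < 1) {m : ℝ → ℝ} (hm : Continuous m) {C : ℂ}
    (h : ∫ θ in (0:ℝ)..2*π, (m θ : ℂ) * fv v (circleMap 0 1 θ) = C) :
    ∫ θ in (0:ℝ)..2*π, m θ * lv v θ = C.re := by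
  have hc := cont_of _ (fv_diff hv)
  have := Complex.reCLM.intervalIntegral_comp_comm (μ := volume) (a := 0) (b := 2*π)
    (f := fun θ => (m θ : ℂ) * fv v (circleMap 0 1 θ))
    (Continuous.intervalIntegrable ((Complex.continuous_ofReal.comp hm).mul hc) _ _)
  rw [h] at this
  simpa [lv_eq] using this

theorem lv_cont {v : ℂ} (hv : ‖v‖ < 1) : Continuous (lv v) := by
  have hc := cont_of _ (fv_diff hv)
  have : lv v = fun θ => (fv v (circleMap 0 1 θ)).re := funext (lv_eq v)
  rw [this]; exact Complex.continuous_re.comp hc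

/-- joukowski -/
def ze (v : ℂ) : ℂ := (v + v⁻¹)/2

def LL (v : ℂ) (θ : ℝ) : ℝ := Real.log ‖2 * (ze v - Real.cos θ)‖

theorem LL_eq {v : ℂ} (h0 : v ≠ 0) (hv : ‖v‖ < 1) (θ : ℝ) :
    LL v θ = -Real.log ‖v‖ + lv v θ + lv (starRingEnd ℂ v) θ := by
  have hz : circleMap 0 1 θ ≠ 0 := circleMap_ne_center one_ne_zero
  have hcos : (Real.cos θ : ℂ) = (circleMap 0 1 θ + (circleMap 0 1 θ)⁻¹)/2 := by
    simp only [circleMap, zero_add, Complex.ofReal_one, one_mul]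
    rw [← Complex.exp_neg]
    push_cast
    rw [Complex.cos]
    ring_nf
  have hconj : starRingEnd ℂ (circleMap 0 1 θ) = (circleMap 0 1 θ)⁻¹ := by
    simp only [circleMap, zero_add, Complex.ofReal_one, one_mul]
    rw [← Complex.exp_conj, ← Complex.exp_neg]
    simp
  have hn : ‖circleMap 0 1 θ‖ = 1 := by simp
  have e1 : 2 * (ze v - Real.cos θ) = v⁻¹ * (1 - v * circleMap 0 1 θ) * (1 - v * (circleMap 0 1 θ)⁻¹) := by
    rw [hcos, ze]; field_simp; ring
  have e2 : ‖1 - v * (circleMap 0 1 θ)⁻¹‖ = ‖1 - (starRingEnd ℂ v) * circleMap 0 1 θ‖ := by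
    rw [← hconj, ← Complex.norm_conj]; simp
  have n1 : ∀ u : ℂ, ‖u‖ < 1 → ‖1 - u * circleMap 0 1 θ‖ ≠ 0 := by
    intro u hu
    rw [norm_ne_zero_iff]
    exact Complex.slitPlane_ne_zero (slit (by rw [norm_mul, hn]; simpa using hu))
  rw [LL, e1, norm_mul, norm_mul, e2, Real.log_mul, Real.log_mul, norm_inv, Real.log_inv]
  · rfl
  · simpa using h0
  · exact n1 v hv
  · exact mul_ne_zero (by simpa using h0) (n1 v hv)
  · exact n1 _ (by simpa using hv)

theorem LL_int {v : ℂ} (h0 : v ≠ 0) (hv : ‖v‖ < 1) {m : ℝ → ℝ} (hm : Continuous m) {C : ℂ → ℂ} {M : ℝ}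
    (hM : ∫ θ in (0:ℝ)..2*π, m θ = M)
    (h : ∀ v, ‖v‖ < 1 → ∫ θ in (0:ℝ)..2*π, (m θ : ℂ) * fv v (circleMap 0 1 θ) = C v) :
    ∫ θ in (0:ℝ)..2*π, m θ * LL v θ = - Real.log ‖v‖ * M + (C v).re + (C (starRingEnd ℂ v)).re := by
  have hv' : ‖starRingEnd ℂ v‖ < 1 := by simpa using hv
  have c1 := lv_cont hv
  have c2 := lv_cont hv'
  have e : ∀ θ, m θ * LL v θ = - Real.log ‖v‖ * m θ + m θ * lv v θ + m θ * lv (starRingEnd ℂ v) θ := by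
    intro θ; rw [LL_eq h0 hv]; ring
  simp only [e]
  rw [intervalIntegral.integral_add, intervalIntegral.integral_add, intervalIntegral.integral_const_mul,
    re_int hv hm (h v hv), re_int hv' hm (h _ hv'), hM]
  all_goals exact Continuous.intervalIntegrable (by fun_prop) _ _

theorem LL_cont {v : ℂ} (h0 : v ≠ 0) (hv : ‖v‖ < 1) : Continuous (LL v) := by
  have hv' : ‖starRingEnd ℂ v‖ < 1 := by simpa using hv
  have c1 := lv_cont hv
  have c2 := lv_cont hv'
  have : LL v = fun θ => -Real.log ‖v‖ + lv v θ + lv (starRingEnd ℂ v) θ := funext (LL_eq h0 hv)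
  rw [this]; fun_prop

theorem A0 {v : ℂ} (h0 : v ≠ 0) (hv : ‖v‖ < 1) :
    ∫ θ in (0:ℝ)..2*π, LL v θ = 2*π * (- Real.log ‖v‖) := by
  have := LL_int h0 hv (m := fun _ => 1) (C := fun _ => 0) (M := 2*π) (by fun_prop) (by simp)
    (fun u hu => by simpa [fv_zero] using cauchyPos 0 (fv_diff hu))
  simp only [one_mul] at this
  rw [this]; simp; ring

theorem int_cos : ∫ θ in (0:ℝ)..2*π, Real.cos θ = 0 := by simp

theorem int_cos2 : ∫ θ in (0:ℝ)..2*π, Real.cos (2*θ) = 0 := by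
  rw [intervalIntegral.integral_comp_mul_left (fun x => Real.cos x) two_ne_zero, integral_cos]
  have := Real.sin_nat_mul_pi 4
  push_cast at this
  simp [show 2 * (2*π) = 4 * π by ring, this]

theorem A1 {v : ℂ} (h0 : v ≠ 0) (hv : ‖v‖ < 1) :
    ∫ θ in (0:ℝ)..2*π, Real.cos θ * LL v θ = 2*π * (- v.re) := by
  have := LL_int h0 hv (m := fun θ => Real.cos θ) (C := fun v => π * (-v)) (M := 0) (by fun_prop) int_cos
    (fun u hu => by simpa [fv_d1] using cosN 1 (fv_diff hu) (fv_zero u))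
  rw [this]; simp; ring

theorem A2 {v : ℂ} (h0 : v ≠ 0) (hv : ‖v‖ < 1) :
    ∫ θ in (0:ℝ)..2*π, Real.cos (2*θ) * LL v θ = 2*π * (- (v^2).re/2) := by
  have := LL_int h0 hv (m := fun θ => Real.cos (2*θ)) (C := fun v => π/2 * (-v^2)) (M := 0) (by fun_prop) int_cos2
    (fun u hu => by simpa [fv_d2] using cosN 2 (fv_diff hu) (fv_zero u))
  rw [this]; simp [pow_two]; ring

theorem int_PK {d : ℝ} (h0 : 0 < d) (h1 : d < 1) : ∫ θ in (0:ℝ)..2*π, PK d θ = 2*π := by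
  have := poissonF h0 h1 (f := fun _ => 1) diffContOnCl_const
  simp only [mul_one] at this
  rw [intervalIntegral.integral_ofReal] at this
  exact_mod_cast this

theorem AP {d : ℝ} (d0 : 0 < d) (d1 : d < 1) {v : ℂ} (h0 : v ≠ 0) (hv : ‖v‖ < 1) :
    ∫ θ in (0:ℝ)..2*π, PK d θ * LL v θ = 2*π * (- Real.log ‖v‖ + 2 * Real.log ‖1 + d * v‖) := by
  have := LL_int h0 hv (C := fun v => 2*π * fv v (-d)) (PK_cont d0 d1) (int_PK d0 d1)
    (fun u hu => poissonF d0 d1 (fv_diff hu))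
  have e : ∀ u : ℂ, (2 * (π:ℂ) * fv u (-d)).re = 2*π * Real.log ‖1 + d * u‖ := by
    intro u
    rw [show (2*(π:ℂ)) = ((2*π:ℝ):ℂ) by push_cast; ring, Complex.re_ofReal_mul, fv, Complex.log_re]
    congr 3; ring_nf
  have e3 : ‖1 + d * (starRingEnd ℂ v)‖ = ‖1 + d * v‖ := by
    rw [← Complex.norm_conj]; simp
  rw [this, e, e, e3]; ring

def RR (d s : ℝ) (v : ℂ) : ℝ :=
  ((ze v).re^2 + (ze v).im^2) * (- Real.log ‖v‖) - 2 * (ze v).re * (-v.re)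
   + (- Real.log ‖v‖ - (v^2).re/2)/2
   + s * ((((ze v).re + (1+d^2)/(2*d))^2 + (ze v).im^2) * (- Real.log ‖v‖ + 2 * Real.log ‖1 + d * v‖)
     + (1-d^2)/(2*d) * (-v.re - (2 * (ze v).re + (1+d^2)/(2*d)) * (- Real.log ‖v‖)))

theorem weight_split {d : ℝ} (d0 : 0 < d) (d1 : d < 1) (s p q θ : ℝ) :
    ((p - Real.cos θ)^2 + q^2) * (1 + s * PK d θ) =
      ((p^2+q^2 + 1/2) - s * ((1-d^2)/(2*d)) * (2*p + (1+d^2)/(2*d)))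
      + (s * ((1-d^2)/(2*d)) - 2*p) * Real.cos θ + 1/2 * Real.cos (2*θ)
      + s * ((p + (1+d^2)/(2*d))^2 + q^2) * PK d θ := by
  have h := (PK_den (θ := θ) d0 d1).ne'
  rw [Real.cos_two_mul, PK]
  generalize Real.cos θ = y at h ⊢
  have e : (1 - d^2) / (1 + d^2 + 2*d*y) * (y + (1+d^2)/(2*d)) = (1-d^2)/(2*d) := by
    rw [div_mul_eq_mul_div, div_eq_div_iff h (by positivity)]
    field_simp
    ring
  generalize (1 - d^2) / (1 + d^2 + 2*d*y) = P at e ⊢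
  generalize (1+d^2)/(2*d) = k at e ⊢
  generalize (1-d^2)/(2*d) = κ at e ⊢
  linear_combination (s * (y - 2 * p - k)) * e

theorem RR_int {d : ℝ} (d0 : 0 < d) (d1 : d < 1) (s : ℝ) {v : ℂ} (h0 : v ≠ 0) (hv : ‖v‖ < 1) :
    ∫ θ in (0:ℝ)..2*π, ‖ze v - Real.cos θ‖^2 * LL v θ * (1 + s * PK d θ) = 2*π * RR d s v := by
  have e : ∀ θ : ℝ, ‖ze v - Real.cos θ‖^2 * LL v θ * (1 + s * PK d θ) =
      (((ze v).re^2+(ze v).im^2 + 1/2) - s * ((1-d^2)/(2*d)) * (2*(ze v).re + (1+d^2)/(2*d))) * LL v θ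
      + (s * ((1-d^2)/(2*d)) - 2*(ze v).re) * (Real.cos θ * LL v θ) + 1/2 * (Real.cos (2*θ) * LL v θ)
      + s * (((ze v).re + (1+d^2)/(2*d))^2 + (ze v).im^2) * (PK d θ * LL v θ) := by
    intro θ
    have h1 : ‖ze v - Real.cos θ‖^2 = ((ze v).re - Real.cos θ)^2 + (ze v).im^2 := by
      rw [← Complex.normSq_eq_norm_sq, Complex.normSq_apply]
      simp [Complex.ofReal_re, Complex.ofReal_im, -Complex.ofReal_cos]; ring
    have h2 := weight_split d0 d1 s (ze v).re (ze v).im θ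
    rw [h1]
    linear_combination (LL v θ) * h2
  simp only [e]
  have c := LL_cont h0 hv
  have c2 := PK_cont d0 d1
  rw [intervalIntegral.integral_add, intervalIntegral.integral_add, intervalIntegral.integral_add,
    intervalIntegral.integral_const_mul, intervalIntegral.integral_const_mul,
    intervalIntegral.integral_const_mul, intervalIntegral.integral_const_mul,
    A0 h0 hv, A1 h0 hv, A2 h0 hv, AP d0 d1 h0 hv, RR]
  · ring
  all_goals exact Continuous.intervalIntegrable (by fun_prop) _ _

theorem ulog_cont : Continuous fun u : ℂ => ‖u‖^2 * Real.log ‖2*u‖ := by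
  have : (fun u : ℂ => ‖u‖^2 * Real.log ‖2*u‖) = fun u => ‖u‖/2 * (‖2*u‖ * Real.log ‖2*u‖) := by
    ext u; simp; ring
  rw [this]
  have h : Continuous fun u : ℂ => ‖2*u‖ * Real.log ‖2*u‖ :=
    Real.continuous_mul_log.comp (by fun_prop : Continuous fun u : ℂ => ‖2*u‖)
  fun_prop

theorem RR_int' {d : ℝ} (d0 : 0 < d) (d1 : d < 1) (s : ℝ) {v : ℂ} (h0 : v ≠ 0) (hv : ‖v‖ ≤ 1) :
    ∫ θ in (0:ℝ)..2*π, ‖ze v - Real.cos θ‖^2 * LL v θ * (1 + s * PK d θ) = 2*π * RR d s v := by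
  have c2 := PK_cont d0 d1
  have hF : Continuous fun ζ : ℂ =>
      ∫ θ in (0:ℝ)..2*π, ‖ζ - Real.cos θ‖^2 * Real.log ‖2*(ζ - Real.cos θ)‖ * (1 + s * PK d θ) := by
    apply intervalIntegral.continuous_parametric_intervalIntegral_of_continuous'
    have h1 : Continuous fun p : ℂ × ℝ => p.1 - (Real.cos p.2 : ℂ) :=
      continuous_fst.sub (Complex.continuous_ofReal.comp (Real.continuous_cos.comp continuous_snd))
    have h2 := ulog_cont.comp h1
    exact h2.mul (by fun_prop)
  have hze : ContinuousAt (fun t : ℝ => ze (t * v)) 1 := by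
    unfold ze
    have : ContinuousAt (fun t : ℝ => (t * v)⁻¹) 1 := ContinuousAt.inv₀ (by fun_prop) (by simpa using h0)
    fun_prop
  have hd : (1:ℂ) + d * v ≠ 0 := by
    intro h
    have : ‖(d:ℂ) * v‖ = 1 := by
      rw [show (d:ℂ) * v = -1 by linear_combination h]; simp
    rw [norm_mul, Complex.norm_real, Real.norm_of_nonneg d0.le] at this
    nlinarith [norm_nonneg v]
  have hR : ContinuousAt (fun t : ℝ => 2*π * RR d s (t*v)) 1 := by
    unfold RR
    have a1 : ContinuousAt (fun t : ℝ => (ze (t * v)).re) 1 := Complex.continuous_re.continuousAt.comp hze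
    have a2 : ContinuousAt (fun t : ℝ => (ze (t * v)).im) 1 := Complex.continuous_im.continuousAt.comp hze
    have a3 : ContinuousAt (fun t : ℝ => Real.log ‖t * v‖) 1 :=
      ContinuousAt.log (by fun_prop) (by simpa using h0)
    have a4 : ContinuousAt (fun t : ℝ => Real.log ‖1 + d * (t * v)‖) 1 :=
      ContinuousAt.log (by fun_prop) (by simpa using hd)
    have a5 : ContinuousAt (fun t : ℝ => (t * v).re) 1 := Complex.continuous_re.continuousAt.comp (by fun_prop)
    have a6 : ContinuousAt (fun t : ℝ => ((t * v)^2).re) 1 := Complex.continuous_re.continuousAt.comp (by fun_prop)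
    fun_prop
  have hL := hF.continuousAt.comp hze
  have t1 := hL.tendsto.mono_left (nhdsWithin_le_nhds (s := Set.Iio 1))
  have t2 := hR.tendsto.mono_left (nhdsWithin_le_nhds (s := Set.Iio 1))
  have ev : ∀ᶠ t : ℝ in 𝓝[<] 1, 0 < t ∧ t < 1 := by
    filter_upwards [Ioo_mem_nhdsLT (show (0:ℝ) < 1 by norm_num)] with t ht using ht
  have := tendsto_nhds_unique_of_eventuallyEq t1 t2 (by
    filter_upwards [ev] with t ht
    have := RR_int d0 d1 s (v := t*v) (mul_ne_zero (by exact_mod_cast ht.1.ne') h0) (by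
      rw [norm_mul, Complex.norm_real, Real.norm_of_nonneg ht.1.le]
      nlinarith [norm_nonneg v])
    simpa [LL] using this)
  simpa [LL] using this

theorem half_int (g : ℝ → ℝ) (hg : ContinuousOn g (Set.Icc (-1) 1)) :
    ∫ θ in (0:ℝ)..2*π, g (Real.cos θ) = 2 * ∫ θ in (0:ℝ)..π, g (Real.cos θ) := by
  have hc : Continuous fun θ => g (Real.cos θ) :=
    hg.comp_continuous Real.continuous_cos (fun θ => ⟨Real.neg_one_le_cos θ, Real.cos_le_one θ⟩)
  rw [← intervalIntegral.integral_add_adjacent_intervals (b := π) (hc.intervalIntegrable _ _) (hc.intervalIntegrable _ _)]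
  have := intervalIntegral.integral_comp_sub_left (a := 0) (b := π) (fun θ => g (Real.cos θ)) (2*π)
  simp only [Real.cos_two_pi_sub] at this
  rw [this]
  ring_nf

theorem phi2_cont : Continuous phi2 := by
  have h := ulog_cont.comp Complex.continuous_ofReal
  have e : phi2 = fun x : ℝ => (3/4)*x^2 - (1/2) * (‖(x:ℂ)‖^2 * Real.log ‖2*(x:ℂ)‖) := by
    ext x
    simp only [phi2, norm_mul, Complex.norm_real, Real.norm_eq_abs, sq_abs, Complex.norm_ofNat]
    ring
  rw [e]
  exact (by fun_prop : Continuous fun x : ℝ => (3/4)*x^2).sub (continuous_const.mul h)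

theorem main_int {d : ℝ} (d0 : 0 < d) (d1 : d < 1) (s : ℝ) {v : ℂ} (h0 : v ≠ 0) (hv : ‖v‖ ≤ 1) (x : ℝ)
    (hx : ze v = x) :
    ∫ θ in (0:ℝ)..2*π, phi2 (x - Real.cos θ) * (1 + s * PK d θ) =
     2*π * (3/4 * (x^2 + 1/2 + s * ((x + (1+d^2)/(2*d))^2 - (1-d^2)/(2*d) * (2*x + (1+d^2)/(2*d))))
       - 1/2 * RR d s v) := by
  have c2 := PK_cont d0 d1
  have e : ∀ θ : ℝ, phi2 (x - Real.cos θ) * (1 + s * PK d θ) =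
     3/4 * (((x^2+0^2 + 1/2) - s * ((1-d^2)/(2*d)) * (2*x + (1+d^2)/(2*d)))
      + (s * ((1-d^2)/(2*d)) - 2*x) * Real.cos θ + 1/2 * Real.cos (2*θ)
      + s * ((x + (1+d^2)/(2*d))^2 + 0^2) * PK d θ)
      - 1/2 * (‖ze v - Real.cos θ‖^2 * LL v θ * (1 + s * PK d θ)) := by
    intro θ
    rw [← weight_split d0 d1]
    have : ‖(x:ℂ) - (Real.cos θ:ℂ)‖ = |x - Real.cos θ| := by
      rw [← Complex.ofReal_sub, Complex.norm_real, Real.norm_eq_abs]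
    rw [LL, hx, norm_mul, this, phi2, sq_abs]
    simp only [Complex.norm_ofNat]
    ring
  have hN : Continuous fun θ : ℝ => ‖ze v - Real.cos θ‖^2 * LL v θ * (1 + s * PK d θ) := by
    have h1 : Continuous fun p : ℝ => ze v - (Real.cos p : ℂ) :=
      continuous_const.sub (Complex.continuous_ofReal.comp Real.continuous_cos)
    exact (ulog_cont.comp h1).mul (by fun_prop)
  simp only [e]
  rw [intervalIntegral.integral_sub, intervalIntegral.integral_const_mul, intervalIntegral.integral_const_mul,
    RR_int' d0 d1 s h0 hv, intervalIntegral.integral_add, intervalIntegral.integral_add,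
    intervalIntegral.integral_add, intervalIntegral.integral_const, intervalIntegral.integral_const_mul,
    intervalIntegral.integral_const_mul, intervalIntegral.integral_const_mul, int_cos, int_cos2, int_PK d0 d1]
  · simp; ring
  all_goals first
    | exact hN.intervalIntegrable _ _
    | exact Continuous.intervalIntegrable (by fun_prop) _ _

/-- from the original integral to the angular one -/
theorem to_angle {d s c : ℝ} (d0 : 0 < d) (d1 : d < 1) (x : ℝ)
    (hw : ∀ z, -1 < z → z < 1 → 2*(1+c*z)/(1+c^2+2*c*z) = 1 + s * ((1-d^2)/(1+d^2+2*d*z))) :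
    (∫ z in (-1:ℝ)..1,
          phi2 (x - z) * (2*(1+c*z)/(π*(1+c^2+2*c*z)*Real.sqrt (1-z^2)))) =
     (2*π)⁻¹ * ∫ θ in (0:ℝ)..2*π, phi2 (x - Real.cos θ) * (1 + s * PK d θ) := by
  have h1 : ∀ z ∈ Set.Ioo (-1:ℝ) 1, phi2 (x - z) * (2*(1+c*z)/(π*(1+c^2+2*c*z)*Real.sqrt (1-z^2)))
     = π⁻¹ * (phi2 (x - z) * (1 + s * ((1-d^2)/(1+d^2+2*d*z))) * √(1 - z^2)⁻¹) := by
    intro z hz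
    rw [← hw z hz.1 hz.2, Real.sqrt_inv]
    simp only [div_eq_mul_inv, mul_inv]
    ring
  have hg : ContinuousOn (fun z => phi2 (x - z) * (1 + s * ((1-d^2)/(1+d^2+2*d*z)))) (Set.Icc (-1) 1) := by
    apply ContinuousOn.mul
    · exact (phi2_cont.comp (by fun_prop : Continuous fun z : ℝ => x - z)).continuousOn
    · apply ContinuousOn.add continuousOn_const
      apply ContinuousOn.mul continuousOn_const
      apply ContinuousOn.div (by fun_prop) (by fun_prop)
      intro z hz
      have := hz.1
      nlinarith
  have h2 := half_int _ hg
  have h3 := Polynomial.Chebyshev.integral_measureT (fun z => phi2 (x - z) * (1 + s * ((1-d^2)/(1+d^2+2*d*z))))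
  rw [Polynomial.Chebyshev.integral_measureT_eq_integral_cos] at h3
  have h4 : (∫ z in (-1:ℝ)..1,
          phi2 (x - z) * (2*(1+c*z)/(π*(1+c^2+2*c*z)*Real.sqrt (1-z^2)))) =
      ∫ z in (-1:ℝ)..1, π⁻¹ * (phi2 (x - z) * (1 + s * ((1-d^2)/(1+d^2+2*d*z))) * √(1 - z^2)⁻¹) := by
    rw [intervalIntegral.integral_of_le (by norm_num), intervalIntegral.integral_of_le (by norm_num),
      integral_Ioc_eq_integral_Ioo, integral_Ioc_eq_integral_Ioo]
    exact setIntegral_congr_fun measurableSet_Ioo h1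
  rw [h4, intervalIntegral.integral_const_mul, ← h3]
  simp only [PK]
  rw [h2]
  rw [mul_inv, ← mul_assoc]
  congr 1
  ring

theorem arccosh_half {Y : ℝ} (hY : 1 ≤ |Y|) : arccosh |(Y + Y⁻¹)/2| = Real.log |Y| := by
  have hne : Y ≠ 0 := by rintro rfl; norm_num at hY
  have hp : 0 < |Y| := by linarith
  have h1 : |(Y + Y⁻¹)/2| = (|Y| + |Y|⁻¹)/2 := by
    rcases lt_or_gt_of_ne hne with h | h
    · have : Y⁻¹ < 0 := inv_lt_zero.mpr h
      rw [abs_of_neg h, abs_of_neg (by linarith), inv_neg]; ring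
    · have : 0 < Y⁻¹ := inv_pos.mpr h
      rw [abs_of_pos h, abs_of_pos (by linarith)]
  rw [arccosh, h1]
  generalize |Y| = u at hY hp
  have h2 : ((u + u⁻¹)/2)^2 - 1 = ((u - u⁻¹)/2)^2 := by field_simp; ring
  have h3 : u⁻¹ ≤ 1 := inv_le_one_of_one_le₀ hY
  rw [h2, Real.sqrt_sq (by linarith)]
  congr 1; ring

theorem RR_in {d s x : ℝ} (d0 : 0 < d) (d1 : d < 1) (hx : |x| ≤ 1) :
    ∃ v : ℂ, v ≠ 0 ∧ ‖v‖ ≤ 1 ∧ ze v = x ∧ RR d s v = 2*x^2 - (2*x^2-1)/4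
      + s * ((x + (1+d^2)/(2*d))^2 * Real.log (1+d^2+2*d*x) - (1-d^2)/(2*d) * x) := by
  obtain ⟨l, r⟩ := abs_le.mp hx
  have hc : Real.cos (Real.arccos x) = x := Real.cos_arccos l r
  set α := Real.arccos x
  have hs := Real.sin_sq_add_cos_sq α
  have hn : ‖Complex.exp (α * Complex.I)‖ = 1 := Complex.norm_exp_ofReal_mul_I α
  have hre : (Complex.exp (α * Complex.I)).re = x := by rw [Complex.exp_ofReal_mul_I_re, hc]
  have him : (Complex.exp (α * Complex.I)).im = Real.sin α := Complex.exp_ofReal_mul_I_im α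
  have hz : ze (Complex.exp (α * Complex.I)) = x := by
    rw [ze, ← Complex.exp_neg, ← hc]; push_cast; rw [Complex.cos]; ring_nf
  have hq : ((Complex.exp (α * Complex.I))^2).re = 2*x^2 - 1 := by
    rw [pow_two, Complex.mul_re, hre, him]; nlinarith
  have hl : 2 * Real.log ‖1 + d * Complex.exp (α * Complex.I)‖ = Real.log (1+d^2+2*d*x) := by
    rw [show (2:ℝ) = ((2:ℕ):ℝ) by norm_num, ← Real.log_pow, ← Complex.normSq_eq_norm_sq, Complex.normSq_apply]
    congr 1
    simp only [Complex.add_re, Complex.add_im, Complex.one_re, Complex.one_im, Complex.re_ofReal_mul,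
      Complex.im_ofReal_mul, hre, him]
    push_cast
    rw [hc] at hs
    linear_combination d^2 * hs
  refine ⟨Complex.exp (α * Complex.I), Complex.exp_ne_zero _, hn.le, hz, ?_⟩
  rw [RR, hz, hn, hl, hq, hre]
  simp only [Complex.ofReal_re, Complex.ofReal_im, Real.log_one]; ring

theorem RR_out {d s x t : ℝ} (hx : x = (t + t⁻¹)/2) :
    ze (t:ℂ) = x ∧ RR d s t = x^2 * (-Real.log |t|) + 2*x*t + (-Real.log |t| - t^2/2)/2
      + s * ((x + (1+d^2)/(2*d))^2 * (-Real.log |t| + 2 * Real.log |1 + d*t|)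
        + (1-d^2)/(2*d) * (-t - (2*x + (1+d^2)/(2*d)) * (-Real.log |t|))) := by
  have hz : ze (t:ℂ) = x := by rw [ze, hx]; push_cast; ring
  refine ⟨hz, ?_⟩
  have h1 : ‖1 + (d:ℂ) * t‖ = |1 + d*t| := by
    rw [← Real.norm_eq_abs, ← Complex.norm_real]; push_cast; rfl
  have h2 : (((t:ℂ))^2).re = t^2 := by rw [← Complex.ofReal_pow, Complex.ofReal_re]
  rw [RR, hz, h1, h2, Complex.norm_real, Real.norm_eq_abs]
  simp only [Complex.ofReal_re, Complex.ofReal_im]; ring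

theorem exists_t {x : ℝ} (hx : 1 < |x|) : ∃ t : ℝ, t ≠ 0 ∧ |t| < 1 ∧ x = (t + t⁻¹)/2 ∧
    Real.sign x * √(x^2-1) = (t⁻¹ - t)/2 := by
  have hq : 0 < x^2 - 1 := by nlinarith [sq_abs x]
  have hs := Real.sq_sqrt hq.le
  have hs0 := Real.sqrt_pos.mpr hq
  set r := √(x^2-1)
  rcases lt_abs.mp hx with h | h
  · have hi : (x - r)⁻¹ = x + r := by
      exact inv_eq_of_mul_eq_one_right (by linarith)
    refine ⟨x - r, ?_, ?_, ?_, ?_⟩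
    · intro h0; nlinarith
    · rw [abs_lt]; constructor <;> nlinarith
    · rw [hi]; ring
    · rw [hi, Real.sign_of_pos (by linarith)]; ring
  · have hi : (x + r)⁻¹ = x - r := by
      exact inv_eq_of_mul_eq_one_right (by linarith)
    refine ⟨x + r, ?_, ?_, ?_, ?_⟩
    · intro h0; nlinarith
    · rw [abs_lt]; constructor <;> nlinarith
    · rw [hi]; ring
    · rw [hi, Real.sign_of_neg (by linarith)]; ring

theorem second_log {d x t : ℝ} (d0 : 0 < d) (d1 : d < 1) (ht : t ≠ 0) (h1 : |t| < 1) (hx : x = (t + t⁻¹)/2) :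
    (x + (1+d^2)/(2*d))^2 * (-Real.log |t| + 2 * Real.log |1 + d*t|) =
     (x + (1+d^2)/(2*d))^2 * Real.log |2*d*(x + (1+d^2)/(2*d))| +
     (x + (1+d^2)/(2*d))^2 * arccosh |(1 + ((1+d^2)/(2*d))*x)/(x + (1+d^2)/(2*d))| := by
  have hf : 2*d*(x + (1+d^2)/(2*d)) = (1+d*t)*(t+d)/t := by
    rw [hx]; field_simp; ring
  obtain ⟨l, r⟩ := abs_lt.mp h1
  have hdt : 0 < 1 + d*t := by nlinarith
  by_cases h0 : t + d = 0
  · have : x + (1+d^2)/(2*d) = 0 := by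
      rw [h0] at hf
      simpa [d0.ne'] using hf
    rw [this]; simp
  have hY : (1 + ((1+d^2)/(2*d))*x)/(x + (1+d^2)/(2*d)) = ((1+d*t)/(t+d) + ((1+d*t)/(t+d))⁻¹)/2 := by
    have hk : x + (1+d^2)/(2*d) = (1+d*t)*(t+d)/(2*d*t) := by
      rw [hx]; field_simp; ring
    rw [hk, hx]
    have := hdt.ne'
    field_simp
    ring
  have hY1 : 1 ≤ |(1+d*t)/(t+d)| := by
    rw [abs_div, one_le_div (abs_pos.mpr h0), ← sq_le_sq]
    nlinarith [mul_nonneg (show 0 ≤ 1 - d^2 by nlinarith) (show 0 ≤ 1 - t^2 by nlinarith)]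
  rw [hY, arccosh_half hY1, hf, ← mul_add]
  congr 1
  have n1 : |1+d*t| ≠ 0 := abs_ne_zero.mpr hdt.ne'
  have n2 : |t+d| ≠ 0 := abs_ne_zero.mpr h0
  have n3 : |t| ≠ 0 := abs_ne_zero.mpr ht
  rw [abs_div, abs_div, abs_mul, Real.log_div (mul_ne_zero n1 n2) n3, Real.log_mul n1 n2, Real.log_div n1 n2]
  ring

/-- `J` with `κ, k` notation. -/
def JJ (d s c x : ℝ) : ℝ := if |x| ≤ 1 then 0 else
    (1/2) * (1 - 1/(2*c^2) + (x + (c^2-1)/(2*c))^2) * arccosh |x|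
    + Real.sign x * ((1 - c^2 - 3*c*x)/(4*c)) * Real.sqrt (x^2-1)
    + s * (1/2) * (x + (1+d^2)/(2*d))^2 *
        arccosh |(1 + ((1+d^2)/(2*d))*x)/(x + (1+d^2)/(2*d))|

theorem value {d s c : ℝ} (c0 : 0 < c) (d0 : 0 < d) (d1 : d < 1) (x : ℝ)
    (hκ : s * ((1-d^2)/(2*d)) = (1-c^2)/(2*c))
    (hκk : s * ((1-d^2)/(2*d)) * ((1+d^2)/(2*d)) = (1-c^4)/(4*c^2))
    (hw : ∀ z, -1 < z → z < 1 → 2*(1+c*z)/(1+c^2+2*c*z) = 1 + s * ((1-d^2)/(1+d^2+2*d*z))) :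
    (∫ z in (-1:ℝ)..1,
          phi2 (x - z) * (2*(1+c*z)/(π*(1+c^2+2*c*z)*Real.sqrt (1-z^2)))) =
     s * (x + (1+d^2)/(2*d))^2 * (3/4 - 1/2 * Real.log |2*d*(x + (1+d^2)/(2*d))|)
      - ((1-c^2)/(2*c)) * x - JJ d s c x + (-3+4*c^2+3*c^4)/(16*c^2) := by
  have hpi := pi_ne_zero
  rw [to_angle d0 d1 x hw]
  by_cases hx : |x| ≤ 1
  · obtain ⟨v, v0, v1, vx, hR⟩ := RR_in (s := s) d0 d1 hx
    rw [main_int d0 d1 s v0 v1 x vx, hR, JJ, if_pos hx, inv_mul_cancel_left₀ (by positivity)]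
    obtain ⟨l, r⟩ := abs_le.mp hx
    have e : 2*d*(x + (1+d^2)/(2*d)) = 1 + d^2 + 2*d*x := by field_simp; ring
    have ep : |1 + d^2 + 2*d*x| = 1 + d^2 + 2*d*x := abs_of_nonneg (by nlinarith)
    rw [e, ep]
    have e2 : (-3+4*c^2+3*c^4)/(16*c^2) = 1/4 - 3/4 * ((1-c^4)/(4*c^2)) := by field_simp; ring
    rw [e2, ← hκk, ← hκ]
    ring
  · obtain ⟨t, t0, t1, xt, hsg⟩ := exists_t (not_le.mp hx)
    obtain ⟨hz, hR⟩ := RR_out (d := d) (s := s) xt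
    rw [main_int d0 d1 s (v := (t:ℂ)) (by exact_mod_cast t0) (by simpa using t1.le) x hz, hR, JJ, if_neg hx,
      inv_mul_cancel_left₀ (by positivity)]
    have hA : arccosh |x| = - Real.log |t| := by
      have := arccosh_half (Y := t⁻¹) (by rw [abs_inv]; exact (one_le_inv₀ (abs_pos.mpr t0)).mpr t1.le)
      rw [inv_inv, add_comm, ← xt, abs_inv, Real.log_inv] at this
      exact this
    have h2 := second_log d0 d1 t0 t1 xt
    rw [hA]
    have e2 : (-3+4*c^2+3*c^4)/(16*c^2) = 1/4 - 3/4 * ((1-c^4)/(4*c^2)) := by field_simp; ring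
    have e3 : (1 - 1/(2*c^2) + (x + (c^2-1)/(2*c))^2) = x^2 + 1/2 - 2 * x * ((1-c^2)/(2*c)) - (1-c^4)/(4*c^2) := by
      field_simp; ring
    have e4 : (1 - c^2 - 3*c*x)/(4*c) = (1-c^2)/(2*c)/2 - 3/4*x := by field_simp; ring
    have e5 : t⁻¹ = 2*x - t := by rw [xt]; ring
    have e6 : 2*x*t = t^2 + 1 := by rw [xt]; field_simp
    rw [e5] at hsg
    rw [e2, e3, e4, ← hκk, ← hκ]
    linear_combination (-s/2) * h2 + (s * ((1-d^2)/(2*d)) /2 - 3/4*x) * hsg  + (-1/8) * e6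

/-- For every `c > 0` and `x ∈ ℝ`:
`∫_{−1}^1 φ₂(x−z)·Ω̃_c″(z) dz = sign(1−c)·(1/c²)·φ₂((1+c²+2cx)/2) − ((1−c²)/(2c))x
  − J̃_c(x) + (−3+4c²+3c⁴)/(16c²) − [c>1](x+(1+c²)/(2c))²·ln c`,
where `Ω̃_c″(z) = 2(1+cz)/(π(1+c²+2cz)√(1−z²))`. -/
theorem phi2_against_Omega_second_deriv :
    ∀ c : ℝ, 0 < c → ∀ x : ℝ,
      (∫ z in (-1:ℝ)..1,
          phi2 (x - z) * (2*(1+c*z)/(π*(1+c^2+2*c*z)*Real.sqrt (1-z^2)))) =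
        Real.sign (1-c) * (1/c^2) * phi2 ((1+c^2+2*c*x)/2)
        - ((1-c^2)/(2*c)) * x - Jtilde c x + (-3+4*c^2+3*c^4)/(16*c^2)
        - (if 1 < c then (x + (1+c^2)/(2*c))^2 * Real.log c else 0) := by
  intro c c0 x
  have hphi : phi2 ((1+c^2+2*c*x)/2) = c^2 * (x + (1+c^2)/(2*c))^2 *
      (3/4 - 1/2 * Real.log |2*c*(x + (1+c^2)/(2*c))|) := by
    have e : (1+c^2+2*c*x)/2 = c * (x + (1+c^2)/(2*c)) := by field_simp; ring
    rw [phi2, e, mul_assoc 2 c, abs_mul 2, abs_of_pos (show (0:ℝ) < 2 by norm_num)]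
    ring
  rw [hphi]
  rcases lt_trichotomy c 1 with h | h | h
  · rw [value (d := c) (s := 1) c0 c0 h x (by ring) (by field_simp; ring) ?_]
    · have hJ : Jtilde c x = JJ c 1 c x := by
        rw [JJ, Jtilde, Real.sign_of_pos (show 0 < 1 - c by linarith), add_comm (c^2) 1]
      have hcc : 1/c^2 * c^2 = 1 := by field_simp
      rw [hJ, if_neg (not_lt.mpr h.le), Real.sign_of_pos (show 0 < 1 - c by linarith)]
      linear_combination (-(x + (1+c^2)/(2*c))^2 *
        (3/4 - 1/2 * Real.log |2*c*(x + (1+c^2)/(2*c))|)) * hcc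
    · intro z h1 h2
      have : 0 < 1 + c^2 + 2*c*z := by nlinarith
      rw [one_mul, eq_comm, ← sub_eq_zero]
      rw [one_add_div this.ne', div_sub_div_same, div_eq_zero_iff]
      left; ring
  · subst h
    rw [value (d := 1/2) (s := 0) c0 (by norm_num) (by norm_num) x (by norm_num) (by norm_num) ?_]
    · rw [JJ, Jtilde]
      simp
    · intro z h1 h2
      have : 1 + 1^2 + 2*1*z ≠ 0 := by intro h; linarith
      rw [zero_mul, add_zero, div_eq_one_iff_eq this]; ring
  · have hk : (1 + (c⁻¹)^2)/(2*c⁻¹) = (1+c^2)/(2*c) := by field_simp; ring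
    rw [value (d := c⁻¹) (s := -1) c0 (inv_pos.mpr c0) (inv_lt_one_of_one_lt₀ h) x (by field_simp; ring)
      (by field_simp; ring) ?_]
    · have hl : (x + (1+c^2)/(2*c))^2 * Real.log |2*c⁻¹*(x + (1+c^2)/(2*c))| =
          (x + (1+c^2)/(2*c))^2 * (Real.log |2*c*(x + (1+c^2)/(2*c))| - 2 * Real.log c) := by
        by_cases h0 : x + (1+c^2)/(2*c) = 0
        · rw [h0]; simp
        · congr 1
          simp only [Real.log_abs]
          rw [Real.log_mul (by positivity) h0, Real.log_mul (by positivity) h0,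
            Real.log_mul two_ne_zero (by positivity), Real.log_mul two_ne_zero c0.ne', Real.log_inv]
          ring
      have hJ : Jtilde c x = JJ c⁻¹ (-1) c x := by
        rw [JJ, Jtilde, Real.sign_of_neg (show 1 - c < 0 by linarith), hk, add_comm (c^2) 1]
      rw [hJ, hk, if_pos h, Real.sign_of_neg (show 1 - c < 0 by linarith)]
      have hcc : 1/c^2 * c^2 = 1 := by field_simp
      linear_combination (1/2) * hl + ((x + (1+c^2)/(2*c))^2 *
        (3/4 - 1/2 * Real.log |2*c*(x + (1+c^2)/(2*c))|)) * hcc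
    · intro z h1 h2
      have p1 : 0 < 1 + c^2 + 2*c*z := by nlinarith
      have e : (1 - (c⁻¹)^2)/(1 + (c⁻¹)^2 + 2*c⁻¹*z) = (c^2-1)/(1+c^2+2*c*z) := by
        rw [← mul_div_mul_left _ _ (pow_ne_zero 2 c0.ne')]
        congr 1 <;> (field_simp; try ring)
      rw [e, eq_comm, ← sub_eq_zero, neg_one_mul, ← sub_eq_add_neg]
      rw [one_sub_div p1.ne', div_sub_div_same, div_eq_zero_iff]
      left; ring
end
end

section
/- For every real z with 0 < |z| < 1: −3 + (1 + 1/z)²·ln(1+z) + (1/z − 1)²·ln(1−z) = −Σ_{k=1}^∞ z^{2k}/(k(k+1)(2k+1)), and in particular the series on the right converges. -/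
open MeasureTheory Real Filter Topology
open scoped Classical

noncomputable section

/-- For real `z` with `0 < |z| < 1` the series
`Σ_{k≥1} z^{2k}/(k(k+1)(2k+1))` converges (indexed here by `k = k'+1`, `k' : ℕ`) and
`−3 + (1+1/z)²·ln(1+z) + (1/z−1)²·ln(1−z) = −Σ_{k≥1} z^{2k}/(k(k+1)(2k+1))`. -/
theorem power_series_identity :
    ∀ z : ℝ, 0 < |z| → |z| < 1 →
      Summable (fun k : ℕ => z^(2*(k+1)) / (((k:ℝ)+1)*((k:ℝ)+2)*(2*(k:ℝ)+3))) ∧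
      -3 + (1+1/z)^2 * Real.log (1+z) + (1/z-1)^2 * Real.log (1-z) =
        -∑' k : ℕ, z^(2*(k+1)) / (((k:ℝ)+1)*((k:ℝ)+2)*(2*(k:ℝ)+3)) := by
  intro z hz0 hz1
  have hz : z ≠ 0 := abs_pos.mp hz0
  have hlt := abs_lt.mp hz1
  have hz2 : |z ^ 2| < 1 := by
    rw [abs_pow]
    exact pow_lt_one₀ (abs_nonneg z) hz1 two_ne_zero
  have hS := Real.hasSum_pow_div_log_of_abs_lt_one hz2
  have hD := Real.hasSum_log_sub_log_of_abs_lt_one hz1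
  have hlog : Real.log (1 - z ^ 2) = Real.log (1 + z) + Real.log (1 - z) := by
    rw [← Real.log_mul (by linarith) (by linarith)]
    congr 1
    ring
  rw [hlog] at hS
  have hS' := (hasSum_nat_add_iff' 1).mpr hS
  have hD' := (hasSum_nat_add_iff' 1).mpr hD
  have key := (hS.add (hS'.mul_left (1 / z ^ 2))).sub (hD'.mul_left (2 / z))
  have main : HasSum (fun k : ℕ => z^(2*(k+1)) / (((k:ℝ)+1)*((k:ℝ)+2)*(2*(k:ℝ)+3)))
      (-(-3 + (1+1/z)^2 * Real.log (1+z) + (1/z-1)^2 * Real.log (1-z))) := by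
    convert key using 1
    · rfl
    · funext k
      have h1 : (k:ℝ) + 1 ≠ 0 := by positivity
      have h2 : (k:ℝ) + 2 ≠ 0 := by positivity
      have h3 : 2 * (k:ℝ) + 3 ≠ 0 := by positivity
      have e1 : (z ^ 2) ^ (k + 1) = z ^ (2 * (k + 1)) := by rw [← pow_mul]
      have e2 : (z ^ 2) ^ (k + 1 + 1) = z ^ (2 * (k + 1)) * z ^ 2 := by
        rw [← pow_mul]; ring
      have e3 : z ^ (2 * (k + 1) + 1) = z ^ (2 * (k + 1)) * z := pow_succ _ _
      rw [e1, e2, e3]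
      push_cast
      rw [show (k:ℝ) + 1 + 1 = k + 2 by ring, show 2 * ((k:ℝ) + 1) + 1 = 2 * k + 3 by ring]
      generalize z ^ (2 * (k + 1)) = w
      field_simp
      ring
    · simp
      field_simp
      ring
  exact ⟨main.summable, by rw [main.tsum_eq, neg_neg]⟩
end
end

section
/- For every c > 0: ∫_{−1}^1 φ₂((1+c²+2cz)/2)·[2(1+cz)/(π·(1+c²+2cz)·√(1−z²))] dz equals 3/8 − c⁴/8 if 0 < c ≤ 1, and equals −1/4 + c²/2 − (ln c)/2 − c²·ln c if c ≥ 1. -/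
open MeasureTheory Real Filter Topology
open scoped Classical

noncomputable section

lemma aux_W_pos {c x : ℝ} (hc : 0 < c) (hx : -1 < x) : 0 < 1+c^2+2*c*x := by
  nlinarith [sq_nonneg (1-c), mul_pos hc (by linarith : 0 < x + 1)]

lemma aux_W_pos' {c x : ℝ} (hc : 0 < c) (h1 : c ≠ 1) (hx : -1 ≤ x) : 0 < 1+c^2+2*c*x := by
  have : 0 < (1-c)^2 := by
    have : 1 - c ≠ 0 := fun h => h1 (by linarith)
    positivity
  nlinarith [mul_nonneg hc.le (by linarith : 0 ≤ x + 1)]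

/-- the trigonometric integrand -/
def auxH (c θ : ℝ) : ℝ :=
  (1+c*cos θ) * (3/8*(1+c^2+2*c*cos θ)
    - 1/4*((1+c^2+2*c*cos θ)*Real.log (1+c^2+2*c*cos θ)))

lemma aux_cov {c : ℝ} (hc : 0 < c) :
    (∫ z in (-1:ℝ)..1,
      phi2 ((1+c^2+2*c*z)/2) * (2*(1+c*z)/(π*(1+c^2+2*c*z)*Real.sqrt (1-z^2)))) =
    π⁻¹ * ∫ θ in (0:ℝ)..π, auxH c θ := by
  have him : cos '' (Set.Ioo 0 π) = Set.Ioo (-1) 1 := by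
    apply Set.Subset.antisymm
    · exact mapsTo_cos_Ioo.image_subset
    · intro x hx
      refine ⟨arccos x, ⟨arccos_pos.2 hx.2, ?_⟩, cos_arccos hx.1.le hx.2.le⟩
      exact lt_of_le_of_ne (arccos_le_pi x) (fun h => by
        rw [arccos_eq_pi] at h; linarith [hx.1])
  rw [intervalIntegral.integral_of_le (by norm_num), integral_Ioc_eq_integral_Ioo, ← him,
    integral_image_eq_integral_abs_deriv_smul measurableSet_Ioo
      (fun x _ => (hasDerivAt_cos x).hasDerivWithinAt)
      (injOn_cos.mono Set.Ioo_subset_Icc_self),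
    ← intervalIntegral.integral_const_mul,
    intervalIntegral.integral_of_le pi_pos.le, integral_Ioc_eq_integral_Ioo]
  apply setIntegral_congr_fun measurableSet_Ioo
  intro θ hθ
  have hs : 0 < sin θ := sin_pos_of_mem_Ioo hθ
  have hW := aux_W_pos hc (mapsTo_cos_Ioo hθ).1
  have hsq : Real.sqrt (1 - cos θ^2) = sin θ := by
    rw [← sin_sq, Real.sqrt_sq hs.le]
  have hl : 2 * |(1+c^2+2*c*cos θ)/2| = 1+c^2+2*c*cos θ := by
    rw [abs_of_pos (by positivity)]; ring
  simp only [smul_eq_mul, abs_neg, abs_of_pos hs, hsq, phi2, auxH, hl]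
  generalize Real.log (1+c^2+2*c*cos θ) = l
  have hpi := pi_pos.ne'
  have hW' := hW.ne'
  have hs' := hs.ne'
  generalize hw : (1+c^2+2*c*cos θ) = w at *
  field_simp
  ring

lemma aux_cont : Continuous fun c : ℝ => ∫ θ in (0:ℝ)..π, auxH c θ := by
  apply intervalIntegral.continuous_parametric_intervalIntegral_of_continuous'
  unfold auxH Function.uncurry
  have : Continuous fun p : ℝ × ℝ => (1+p.1^2+2*p.1*cos p.2) := by fun_prop
  have := Real.continuous_mul_log.comp this
  simp only [Function.comp_def] at this
  fun_prop

lemma aux_K_lt {c : ℝ} (hc : 0 < c) (h1 : c < 1) :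
    ∫ θ in (0:ℝ)..π, (1+c^2+2*c*cos θ)⁻¹ = π / (1-c^2) := by
  have hp : ∀ θ, 0 < 1 + c * cos θ := fun θ => by nlinarith [neg_one_le_cos θ]
  have hW : ∀ θ, 0 < 1+c^2+2*c*cos θ := fun θ => aux_W_pos' hc h1.ne (neg_one_le_cos θ)
  have hc2 : 0 < 1 - c^2 := by nlinarith
  have hd : ∀ θ, HasDerivAt
      (fun θ => (θ - 2 * arctan (c * sin θ / (1 + c * cos θ))) / (1-c^2))
      ((1+c^2+2*c*cos θ)⁻¹) θ := by
    intro θ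
    have hq := (((hasDerivAt_sin θ).const_mul c).div
      (((hasDerivAt_cos θ).const_mul c).const_add 1) (hp θ).ne').arctan
    have := (((hasDerivAt_id θ).sub (hq.const_mul 2)).div_const (1-c^2))
    refine this.congr_deriv ?_
    have e : 1 + (c * sin θ / (1 + c * cos θ))^2 = (1+c^2+2*c*cos θ)/(1 + c * cos θ)^2 := by
      have := (hp θ).ne'
      field_simp
      rw [sin_sq]; ring
    simp only [Pi.div_apply, e]
    have a1 := (hp θ).ne'
    have a2 := (hW θ).ne'
    have a3 := hc2.ne'
    have e2 : c * cos θ * (1 + c * cos θ) - c * sin θ * (c * -sin θ) = c * cos θ + c^2 := by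
      have := sin_sq θ
      linear_combination c^2 * this
    rw [e2]
    generalize hw : (1+c^2+2*c*cos θ) = w at *
    field_simp
    rw [← hw]; ring
  rw [intervalIntegral.integral_eq_sub_of_hasDerivAt (fun θ _ => hd θ)]
  · simp
  · apply Continuous.intervalIntegrable
    exact Continuous.inv₀ (by fun_prop) (fun θ => (hW θ).ne')

lemma aux_K_gt {c : ℝ} (h1 : 1 < c) :
    ∫ θ in (0:ℝ)..π, (1+c^2+2*c*cos θ)⁻¹ = π / (c^2-1) := by
  have hc : 0 < c := by linarith
  have h := aux_K_lt (inv_pos.2 hc) (inv_lt_one_of_one_lt₀ h1)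
  have e : ∀ θ, (1+c^2+2*c*cos θ)⁻¹ = (c^2)⁻¹ * (1+(c⁻¹)^2+2*c⁻¹*cos θ)⁻¹ := by
    intro θ
    rw [← mul_inv]; congr 1
    field_simp; ring
  simp_rw [e]
  rw [intervalIntegral.integral_const_mul, h]
  have : c^2 - 1 ≠ 0 := by nlinarith
  have : 1 - (c⁻¹)^2 ≠ 0 := by
    have : 1 - (c⁻¹)^2 = (c^2-1)/c^2 := by field_simp
    rw [this]; positivity
  field_simp

lemma aux_L {c : ℝ} (hc : 0 < c) (h1 : c ≠ 1) :
    ∫ θ in (0:ℝ)..π, Real.log (1+c^2+2*c*cos θ) = 2 * π * log⁺ c := by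
  have h := circleAverage_log_norm_add_const_eq_posLog (a := (c:ℂ))
  have hW : ∀ θ, 0 < 1+c^2+2*c*cos θ := fun θ => aux_W_pos' hc h1 (neg_one_le_cos θ)
  have hcont : Continuous fun θ => Real.log (1+c^2+2*c*cos θ) :=
    Continuous.log (by fun_prop) (fun θ => (hW θ).ne')
  have e : ∀ θ : ℝ, Real.log ‖circleMap 0 1 θ + (c:ℂ)‖ = 1/2 * Real.log (1+c^2+2*c*cos θ) := by
    intro θ
    have : 1+c^2+2*c*cos θ = ‖circleMap 0 1 θ + (c:ℂ)‖^2 := by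
      rw [← Complex.normSq_eq_norm_sq, Complex.normSq_apply]
      simp [circleMap, Complex.exp_ofReal_mul_I_re, Complex.exp_ofReal_mul_I_im]
      linear_combination -(sin_sq_add_cos_sq θ)
    rw [this, Real.log_pow]; push_cast; ring
  have hsym : ∫ θ in π..(2*π), Real.log (1+c^2+2*c*cos θ)
      = ∫ θ in (0:ℝ)..π, Real.log (1+c^2+2*c*cos θ) := by
    have := intervalIntegral.integral_comp_sub_left (a := 0) (b := π)
      (fun θ => Real.log (1+c^2+2*c*cos θ)) (2*π)
    simp only [cos_two_pi_sub, sub_zero] at this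
    rw [this]; congr 1; ring
  have hadd := intervalIntegral.integral_add_adjacent_intervals
    (hcont.intervalIntegrable (μ := volume) 0 π) (hcont.intervalIntegrable (μ := volume) π (2*π))
  rw [hsym] at hadd
  rw [circleAverage_def] at h
  simp only [e, intervalIntegral.integral_const_mul, smul_eq_mul, Complex.norm_real,
    Real.norm_eq_abs, abs_of_pos hc] at h
  rw [← hadd] at h
  have := pi_pos.ne'
  field_simp at h
  linarith

lemma aux_main {c : ℝ} (hc : 0 < c) (h1 : c ≠ 1) :
    ∫ θ in (0:ℝ)..π, auxH c θ =
      (3/8*(1+2*c^2) - 1/4*(5/4+5*c^2/2+c^4/4 - c^2/2)) * π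
      - 1/4*(1+2*c^2) * (∫ θ in (0:ℝ)..π, Real.log (1+c^2+2*c*cos θ))
      + (1-c^2)^2*(5+c^2)/16 * ∫ θ in (0:ℝ)..π, (1+c^2+2*c*cos θ)⁻¹ := by
  have hW : ∀ θ, 0 < 1+c^2+2*c*cos θ := fun θ => aux_W_pos' hc h1 (neg_one_le_cos θ)
  have hlc : Continuous fun θ => Real.log (1+c^2+2*c*cos θ) :=
    Continuous.log (by fun_prop) (fun θ => (hW θ).ne')
  have hic : Continuous fun θ => (1+c^2+2*c*cos θ)⁻¹ :=
    Continuous.inv₀ (by fun_prop) (fun θ => (hW θ).ne')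
  have hHc : Continuous (auxH c) := by unfold auxH; fun_prop
  have hd : ∀ θ, HasDerivAt
      (fun θ => sin θ * ((3/8*(3*c+c^3) + (5*c/2+c^3/2)/4 + c^2/2*cos θ)
        - 1/4*((3*c+c^3 + c^2*cos θ) * Real.log (1+c^2+2*c*cos θ))))
      (auxH c θ - (3/8*(1+2*c^2) - 1/4*(5/4+5*c^2/2+c^4/4 - c^2/2))
        + 1/4*(1+2*c^2) * Real.log (1+c^2+2*c*cos θ)
        - (1-c^2)^2*(5+c^2)/16 * (1+c^2+2*c*cos θ)⁻¹) θ := by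
    intro θ
    have dc := hasDerivAt_cos θ
    have dl := ((dc.const_mul (2*c)).const_add (1+c^2)).log (hW θ).ne'
    have := (hasDerivAt_sin θ).mul
      (((dc.const_mul (c^2/2)).const_add (3/8*(3*c+c^3) + (5*c/2+c^3/2)/4)).sub
        ((((dc.const_mul (c^2)).const_add (3*c+c^3)).mul dl).const_mul (1/4)))
    refine this.congr_deriv ?_
    unfold auxH
    simp only [Pi.mul_apply, Pi.sub_apply]
    have a2 := (hW θ).ne'
    have hs := sin_sq θ
    generalize Real.log (1+c^2+2*c*cos θ) = l
    generalize sin θ = s at *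
    generalize cos θ = x at *
    have hv := inv_mul_cancel₀ a2
    rw [div_eq_mul_inv (2 * c * -s)]
    generalize (1+c^2+2*c*x)⁻¹ = v at *
    linear_combination (-c^2/2 + c^2*l/4 + (3*c+c^3+c^2*x)*c*v/2) * hs
      + (-c^2*x^2 - (5*c/2+c^3/2)*x + (5/4+5*c^2/2+c^4/4))/4 * hv
  have hF := intervalIntegral.integral_eq_sub_of_hasDerivAt (a := 0) (b := π) (fun θ _ => hd θ)
    (Continuous.intervalIntegrable (by fun_prop) _ _)
  rw [intervalIntegral.integral_sub, intervalIntegral.integral_add, intervalIntegral.integral_sub,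
    intervalIntegral.integral_const_mul, intervalIntegral.integral_const_mul,
    intervalIntegral.integral_const] at hF
  · simp only [sin_pi, sin_zero, zero_mul, sub_zero, smul_eq_mul] at hF
    linarith
  all_goals exact Continuous.intervalIntegrable (by fun_prop) _ _

lemma aux_lt {c : ℝ} (hc : 0 < c) (h1 : c < 1) :
    ∫ θ in (0:ℝ)..π, auxH c θ = π * (3/8 - c^4/8) := by
  rw [aux_main hc h1.ne, aux_L hc h1.ne, aux_K_lt hc h1,
    posLog_eq_zero_iff _ |>.2 (by rw [abs_of_pos hc]; exact h1.le)]
  have : 1 - c^2 ≠ 0 := by nlinarith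
  field_simp
  ring

lemma aux_gt {c : ℝ} (h1 : 1 < c) :
    ∫ θ in (0:ℝ)..π, auxH c θ =
      π * (-1/4 + c^2/2 - Real.log c/2 - c^2*Real.log c) := by
  have hc : 0 < c := by linarith
  rw [aux_main hc h1.ne', aux_L hc h1.ne', aux_K_gt h1,
    posLog_eq_log (by rw [abs_of_pos hc]; exact h1.le)]
  have : c^2 - 1 ≠ 0 := by nlinarith
  field_simp
  ring

lemma aux_one : ∫ θ in (0:ℝ)..π, auxH 1 θ = π * (1/4) := by
  have t1 : Tendsto (fun c : ℝ => ∫ θ in (0:ℝ)..π, auxH c θ) (𝓝[<] 1)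
      (𝓝 (∫ θ in (0:ℝ)..π, auxH 1 θ)) := (aux_cont.tendsto 1).mono_left nhdsWithin_le_nhds
  have t2 : Tendsto (fun c : ℝ => π * (3/8 - c^4/8)) (𝓝[<] 1) (𝓝 (π * (3/8 - 1^4/8))) :=
    ((by fun_prop : Continuous (fun c : ℝ => π * (3/8 - c^4/8))).tendsto 1).mono_left
      nhdsWithin_le_nhds
  have t3 := t2.congr' (f₂ := fun c : ℝ => ∫ θ in (0:ℝ)..π, auxH c θ) (by
    filter_upwards [Ioo_mem_nhdsLT (show (0:ℝ) < 1 by norm_num)] with c hc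
    exact (aux_lt hc.1 hc.2).symm)
  rw [tendsto_nhds_unique t1 t3]; norm_num

/-- For `c > 0`,
`∫_{−1}^1 φ₂((1+c²+2cz)/2)·(2(1+cz)/(π(1+c²+2cz)√(1−z²))) dz`
equals `3/8 − c⁴/8` if `0 < c ≤ 1` and `−1/4 + c²/2 − (ln c)/2 − c²·ln c` if `c ≥ 1`. -/
theorem phi2_Omega_second_deriv_integral :
    ∀ c : ℝ, 0 < c →
      (c ≤ 1 →
        (∫ z in (-1:ℝ)..1,
            phi2 ((1+c^2+2*c*z)/2) * (2*(1+c*z)/(π*(1+c^2+2*c*z)*Real.sqrt (1-z^2)))) =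
          3/8 - c^4/8) ∧
      (1 ≤ c →
        (∫ z in (-1:ℝ)..1,
            phi2 ((1+c^2+2*c*z)/2) * (2*(1+c*z)/(π*(1+c^2+2*c*z)*Real.sqrt (1-z^2)))) =
          -1/4 + c^2/2 - Real.log c/2 - c^2*Real.log c) := by
  intro c hc
  rw [aux_cov hc]
  have hpi := pi_pos.ne'
  refine ⟨fun h => ?_, fun h => ?_⟩
  · rcases h.lt_or_eq with h | rfl
    · rw [aux_lt hc h]; field_simp
    · rw [aux_one, inv_mul_cancel_left₀ hpi]; norm_num
  · rcases h.lt_or_eq with h | rfl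
    · rw [aux_gt h, inv_mul_cancel_left₀ hpi]
    · rw [aux_one, inv_mul_cancel_left₀ hpi]; norm_num
end
end

section
/- For every c > 0: (1/π)·∫_{−1}^1 z·ln(1+c²+2cz)/√(1−z²) dz equals c if 0 < c ≤ 1, and equals 1/c if c ≥ 1. -/
open MeasureTheory Real Filter Topology
open scoped Classical

noncomputable section

theorem aux_cont_s12 (a b : ℝ) (hb : 0 < b) (hab : b ≤ a) :
    Continuous (fun t : ℝ => sin t * log (a^2+b^2+2*a*b*cos t)
      + (a^2-b^2)/(a*b) * arctan (b * sin t / (a + b * cos t))) := by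
  have ha : 0 < a := hb.trans_le hab
  rcases hab.eq_or_lt with rfl | h
  · have h1 : (fun t : ℝ => sin t * log (b^2+b^2+2*b*b*cos t)
      + (b^2-b^2)/(b*b) * arctan (b * sin t / (b + b * cos t))) =
      fun t => (2/b) * sin (t/2) * ((2*b*cos (t/2)) * log (2*b*cos (t/2))) := by
      funext t
      have hc : cos t = 2 * cos (t/2)^2 - 1 := by
        rw [← cos_two_mul]; congr 1; ring
      have hs : sin t = 2 * sin (t/2) * cos (t/2) := by
        rw [← sin_two_mul]; congr 1; ring
      have hl : b^2+b^2+2*b*b*cos t = (2*b*cos (t/2))^2 := by rw [hc]; ring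
      rw [hl, log_pow, hs]
      field_simp
      push_cast
      ring
    rw [h1]
    have := Real.continuous_mul_log.comp
      (show Continuous (fun t : ℝ => 2*b*cos (t/2)) by fun_prop)
    exact Continuous.mul (by fun_prop) this
  · have h1 : ∀ t : ℝ, 0 < a + b * cos t := fun t => by nlinarith [neg_one_le_cos t]
    have h2 : ∀ t : ℝ, 0 < a^2+b^2+2*a*b*cos t := fun t => by
      nlinarith [neg_one_le_cos t, mul_pos ha hb, sq_pos_of_pos (sub_pos.2 h)]
    have h3 : Continuous (fun t : ℝ => log (a^2+b^2+2*a*b*cos t)) :=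
      Continuous.log (by fun_prop) (fun t => (h2 t).ne')
    have h4 : Continuous (fun t : ℝ => b * sin t / (a + b * cos t)) :=
      Continuous.div (by fun_prop) (by fun_prop) (fun t => (h1 t).ne')
    fun_prop

theorem aux_deriv (a b : ℝ) (hb : 0 < b) (hab : b ≤ a) (t : ℝ) (ht : t ∈ Set.Ioo 0 π) :
    HasDerivAt (fun t : ℝ => (sin t * log (a^2+b^2+2*a*b*cos t)
      + (a^2-b^2)/(a*b) * arctan (b * sin t / (a + b * cos t))) - sin t + b/a * t)
      (cos t * log (a^2+b^2+2*a*b*cos t)) t := by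
  have ha : 0 < a := hb.trans_le hab
  have hs : 0 < sin t := sin_pos_of_pos_of_lt_pi ht.1 ht.2
  have hcs := sin_sq_add_cos_sq t
  have hc : -1 < cos t := by nlinarith
  have h1 : 0 < a + b * cos t := by nlinarith
  have h2 : 0 < a^2+b^2+2*a*b*cos t := by
      nlinarith [mul_pos ha hb, sq_nonneg (a-b)]
  have d1 : HasDerivAt (fun t : ℝ => a^2+b^2+2*a*b*cos t) (2*a*b*(-sin t)) t :=
    ((hasDerivAt_cos t).const_mul _).const_add _
  have d2 : HasDerivAt (fun t : ℝ => a + b*cos t) (b*(-sin t)) t :=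
    ((hasDerivAt_cos t).const_mul _).const_add _
  have d3 := (((hasDerivAt_sin t).const_mul b).fun_div d2 h1.ne').arctan
  have d4 := (hasDerivAt_sin t).fun_mul (d1.log h2.ne')
  have d5 := ((d4.fun_add (d3.const_mul ((a^2-b^2)/(a*b)))).fun_sub (hasDerivAt_sin t)).fun_add
    ((hasDerivAt_id' t).const_mul (b/a))
  refine d5.congr_deriv ?_
  have e : 1 / (1 + (b * sin t / (a + b * cos t))^2) = (a + b * cos t)^2/(a^2+b^2+2*a*b*cos t) := by
    have : 1 + (b * sin t / (a + b * cos t))^2 = (a^2+b^2+2*a*b*cos t)/(a + b * cos t)^2 := by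
      field_simp
      linear_combination b^2 * hcs
    rw [this, one_div_div]
  rw [e]
  have hb0 := hb.ne'
  have ha0 := ha.ne'
  have h10 := h1.ne'
  have h20 := h2.ne'
  clear d1 d2 d3 d4 d5 e
  generalize log (a^2+b^2+2*a*b*cos t) = L
  generalize hD : a^2+b^2+2*a*b*cos t = D at *
  generalize cos t = x at *
  generalize sin t = y at *
  have hy : y^2 = 1 - x^2 := by linarith
  have e2 : (a + b * x)^2 / D * ((b * x * (a + b * x) - b * y * (b * -y)) / (a + b * x)^2)
      = (a * b * x + b^2) / D := by
    rw [div_mul_div_comm, mul_comm D, mul_div_mul_left _ _ (pow_ne_zero 2 h10)]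
    congr 1
    linear_combination b^2 * hcs
  rw [e2]
  field_simp
  ring_nf
  simp only [hy, ← hD]
  ring

theorem aux_z (a b : ℝ) (hb : 0 < b) (hab : b ≤ a) :
    ∫ z in (-1:ℝ)..1, z * Real.log (a^2+b^2+2*a*b*z) / Real.sqrt (1-z^2) = π * (b/a) := by
  have h0 := Polynomial.Chebyshev.integral_measureT (fun z => z * Real.log (a^2+b^2+2*a*b*z))
  rw [Polynomial.Chebyshev.integral_measureT_eq_integral_cos] at h0
  simp only [Real.sqrt_inv, ← div_eq_mul_inv] at h0
  rw [← h0, intervalIntegral.integral_eq_sub_of_hasDerivAt_of_le pi_pos.le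
    (((aux_cont_s12 a b hb hab).sub continuous_sin).add
      (continuous_const.mul continuous_id)).continuousOn
    (aux_deriv a b hb hab)]
  · simp
    ring
  · have : MeromorphicOn (fun t : ℝ => a^2+b^2+2*a*b*cos t) (Set.uIcc 0 π) := by
      apply AnalyticOnNhd.meromorphicOn
      intro x _
      fun_prop
    have := this.intervalIntegrable_log
    exact this.continuousOn_mul continuous_cos.continuousOn

/-- For `c > 0`, `(1/π)∫_{−1}^1 z·ln(1+c²+2cz)/√(1−z²) dz`
equals `c` if `0 < c ≤ 1` and `1/c` if `c ≥ 1`. -/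
theorem log_weighted_arcsine_integral :
    ∀ c : ℝ, 0 < c →
      (c ≤ 1 →
        (1/π) * (∫ z in (-1:ℝ)..1, z * Real.log (1+c^2+2*c*z) / Real.sqrt (1-z^2)) = c) ∧
      (1 ≤ c →
        (1/π) * (∫ z in (-1:ℝ)..1, z * Real.log (1+c^2+2*c*z) / Real.sqrt (1-z^2)) = 1/c) := by
  intro c hc
  constructor
  · intro h
    have h1 := aux_z 1 c hc h
    simp only [one_pow, mul_one, div_one] at h1
    rw [h1]
    field_simp
  · intro h
    have h1 := aux_z c 1 one_pos h
    simp only [one_pow, mul_one] at h1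
    rw [add_comm (1:ℝ) (c^2), h1]
    field_simp
end
end

section
/- For every c > 0 with c ≠ 1: ∫_{−1}^1 √(1−w²)/((1+c²)/(2c) + w) dw equals c·π if 0 < c < 1, and equals π/c if c > 1. -/
open MeasureTheory Real Filter Topology
open scoped Classical

noncomputable section

theorem semicircle_aux (a s : ℝ) (ha : 1 < a) (hs : 0 < s) (has : s^2 = a^2 - 1) :
    (∫ w in (-1:ℝ)..1, Real.sqrt (1-w^2) / (a + w)) = (a - s) * π := by
  have hpos : ∀ w ∈ Set.Icc (-1:ℝ) 1, a + w ≠ 0 := fun w hw => by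
    have := hw.1
    linarith
  have key := intervalIntegral.integral_eq_sub_of_hasDerivAt_of_le (a := (-1:ℝ)) (b := 1)
    (f := fun w => a * arcsin w + √(1-w^2) - s * arcsin ((1+a*w)/(a+w)))
    (f' := fun w => √(1-w^2) / (a + w)) (by norm_num) ?_ ?_ ?_
  · rw [key]
    have h1 : (1 + a * 1) / (a + 1) = 1 := by
      rw [div_eq_one_iff_eq (by linarith)]; ring
    have h2 : (1 + a * (-1)) / (a + (-1)) = -1 := by
      rw [div_eq_iff (by linarith)]; ring
    simp only [h1, h2, arcsin_one, arcsin_neg_one]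
    norm_num
    ring
  · have : ContinuousOn (fun w : ℝ => (1+a*w)/(a+w)) (Set.Icc (-1) 1) :=
      ContinuousOn.div (by fun_prop) (by fun_prop) hpos
    have h3 := continuous_arcsin.comp_continuousOn this
    have h4 : Continuous (fun w : ℝ => a * arcsin w + √(1-w^2)) := by
      have := continuous_arcsin
      fun_prop
    exact h4.continuousOn.sub (continuousOn_const.mul h3)
  · intro w hw
    obtain ⟨hw1, hw2⟩ := hw
    have hq : 0 < 1 - w^2 := by nlinarith
    have hr : 0 < √(1-w^2) := Real.sqrt_pos.2 hq
    have hr2 : √(1-w^2)^2 = 1 - w^2 := Real.sq_sqrt hq.le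
    have hp : 0 < a + w := by linarith
    have d1 := (hasDerivAt_arcsin (x := w) (by linarith) (by linarith)).const_mul a
    have d2 : HasDerivAt (fun w : ℝ => √(1-w^2)) (-(2*w) / (2*√(1-w^2))) w := by
      have := ((hasDerivAt_pow 2 w).const_sub 1).sqrt hq.ne'
      simpa using this
    have d3 : HasDerivAt (fun w : ℝ => (1+a*w)/(a+w)) (s^2/(a+w)^2) w := by
      have n1 : HasDerivAt (fun w : ℝ => 1+a*w) a w := by
        simpa using ((hasDerivAt_id w).const_mul a).const_add 1
      have n2 : HasDerivAt (fun w : ℝ => a+w) 1 w := (hasDerivAt_id w).const_add a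
      refine (n1.div n2 hp.ne').congr_deriv ?_
      rw [has]; ring
    have hu1 : (1+a*w)/(a+w) < 1 := by rw [div_lt_one hp]; nlinarith
    have hu2 : -1 < (1+a*w)/(a+w) := by rw [lt_div_iff₀ hp]; nlinarith
    have d4 := (((hasDerivAt_arcsin hu2.ne' hu1.ne).comp w d3).const_mul s)
    have hsq : √(1 - ((1+a*w)/(a+w))^2) = s * √(1-w^2) / (a+w) := by
      rw [Real.sqrt_eq_iff_mul_self_eq_of_pos (by positivity)]
      field_simp
      rw [hr2, has]; ring
    refine ((d1.add d2).sub d4).congr_deriv ?_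
    rw [hsq]
    field_simp
    rw [hr2, has]; ring
  · apply ContinuousOn.intervalIntegrable
    rw [Set.uIcc_of_le (by norm_num)]
    exact ContinuousOn.div (by fun_prop) (by fun_prop) hpos

/-- For `c > 0` with `c ≠ 1`, `∫_{−1}^1 √(1−w²)/((1+c²)/(2c)+w) dw`
equals `cπ` if `0 < c < 1` and `π/c` if `c > 1`. -/
theorem semicircle_cauchy_integral :
    ∀ c : ℝ, 0 < c → c ≠ 1 →
      (c < 1 →
        (∫ w in (-1:ℝ)..1, Real.sqrt (1-w^2) / ((1+c^2)/(2*c) + w)) = c*π) ∧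
      (1 < c →
        (∫ w in (-1:ℝ)..1, Real.sqrt (1-w^2) / ((1+c^2)/(2*c) + w)) = π/c) := by
  intro c hc hc1
  have ha : 1 < (1+c^2)/(2*c) := by
    rw [lt_div_iff₀ (by positivity)]
    nlinarith [sq_pos_of_ne_zero (sub_ne_zero.2 hc1)]
  refine ⟨fun h => ?_, fun h => ?_⟩
  · rw [semicircle_aux _ ((1-c^2)/(2*c)) ha (div_pos (by nlinarith) (by positivity))
      (by field_simp; ring)]
    field_simp; ring
  · rw [semicircle_aux _ ((c^2-1)/(2*c)) ha (div_pos (by nlinarith) (by positivity))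
      (by field_simp; ring)]
    field_simp; ring
end
end
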